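/- arXiv:2010.09218 — 2 statements merged into one kernel-verified Lean document; each statement's English description precedes it below -/
import Mathlib

section
/- For every integer n ≥ 1 and every real φ₀ > 0, the improper integrals ∫_{φ₀}^{∞} √(φ^{n−1}/F_n(φ)) dφ and ∫_{0}^{φ₀} √(φ^{n−1}/F_n(φ)) dφ both diverge to +∞. (These are the radial arclength integrals of the Heisenberg soliton metric toward the two ends; their divergence is the key step in the completeness proof.) -/
open MeasureTheory Filter Set

/-- `Fn n φ = (2·(−1)^(n+1)·(n+1)!/φ)·(∑_{k=0}^{n+1} (−1)^k φ^k/k! − e^{−φ})`. -/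
noncomputable def Fn (n : ℕ) (φ : ℝ) : ℝ :=
  2 * (-1 : ℝ) ^ (n + 1) * (Nat.factorial (n + 1)) / φ *
    ((∑ k ∈ Finset.range (n + 2), (-1 : ℝ) ^ k * φ ^ k / (Nat.factorial k)) - Real.exp (-φ))

/-- The Taylor remainder of order `m` of `x ↦ exp (-x)` at `0`, normalised to be positive
on `(0, ∞)`. -/
noncomputable def expNegRemainder (m : ℕ) (x : ℝ) : ℝ :=
  (-1 : ℝ) ^ m * (Real.exp (-x) - ∑ k ∈ Finset.range m, (-1 : ℝ) ^ k * x ^ k / (Nat.factorial k))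

lemma expNegRemainder_succ_zero (m : ℕ) : expNegRemainder (m + 1) 0 = 0 := by
  simp [expNegRemainder, Finset.sum_range_succ']

lemma hasDerivAt_pow_succ_div_factorial (m : ℕ) (x : ℝ) :
    HasDerivAt (fun y : ℝ => y ^ (m + 1) / (Nat.factorial (m + 1))) (x ^ m / (Nat.factorial m)) x := by
  refine ((hasDerivAt_pow (m + 1) x).div_const (Nat.factorial (m + 1) : ℝ)).congr_deriv ?_
  have h : (Nat.factorial m : ℝ) ≠ 0 := by positivity
  rw [Nat.factorial_succ]
  push_cast
  field_simp

lemma hasDerivAt_expNegRemainder_succ (m : ℕ) (x : ℝ) :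
    HasDerivAt (expNegRemainder (m + 1)) (expNegRemainder m x) x := by
  have hsum : HasDerivAt
      (fun y : ℝ => ∑ k ∈ Finset.range (m + 1), (-1 : ℝ) ^ k * y ^ k / (Nat.factorial k))
      (-∑ k ∈ Finset.range m, (-1 : ℝ) ^ k * x ^ k / (Nat.factorial k)) x := by
    simp only [Finset.sum_range_succ', pow_zero, mul_one]
    rw [← Finset.sum_neg_distrib]
    refine (HasDerivAt.fun_sum fun k _ => ?_).add_const _
    simp only [mul_div_assoc]
    refine ((hasDerivAt_pow_succ_div_factorial k x).const_mul ((-1 : ℝ) ^ (k + 1))).congr_deriv ?_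
    ring
  have hexp : HasDerivAt (fun y : ℝ => Real.exp (-y)) (-Real.exp (-x)) x := by
    simpa using (hasDerivAt_neg x).exp
  refine ((hexp.sub hsum).const_mul ((-1 : ℝ) ^ (m + 1))).congr_deriv ?_
  simp only [expNegRemainder]
  ring

lemma expNegRemainder_pos (m : ℕ) {x : ℝ} (hx : 0 < x) : 0 < expNegRemainder m x := by
  induction m generalizing x with
  | zero => simpa [expNegRemainder] using Real.exp_pos (-x)
  | succ m ih =>
    have hmono : StrictMonoOn (expNegRemainder (m + 1)) (Ici 0) := by
      refine strictMonoOn_of_deriv_pos (convex_Ici 0)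
        (fun y _ => (hasDerivAt_expNegRemainder_succ m y).continuousAt.continuousWithinAt) ?_
      intro y hy
      rw [interior_Ici] at hy
      rw [(hasDerivAt_expNegRemainder_succ m y).deriv]
      exact ih hy
    simpa [expNegRemainder_succ_zero] using hmono self_mem_Ici hx.le hx

lemma expNegRemainder_le (m : ℕ) {x : ℝ} (hx : 0 ≤ x) :
    expNegRemainder m x ≤ x ^ m / (Nat.factorial m) := by
  induction m generalizing x with
  | zero => simpa [expNegRemainder] using hx
  | succ m ih =>
    have hd (y : ℝ) := (hasDerivAt_pow_succ_div_factorial m y).sub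
      (hasDerivAt_expNegRemainder_succ m y)
    have hmono := monotoneOn_of_deriv_nonneg (convex_Ici (0 : ℝ))
      (fun y _ => (hd y).continuousAt.continuousWithinAt)
      (fun y _ => (hd y).differentiableAt.differentiableWithinAt) (by
        intro y hy
        rw [interior_Ici] at hy
        rw [(hd y).deriv]
        exact sub_nonneg.2 (ih (le_of_lt hy)))
    simpa [expNegRemainder_succ_zero] using hmono self_mem_Ici hx hx

lemma Fn_eq_expNegRemainder (n : ℕ) (φ : ℝ) :
    Fn n φ = 2 * (Nat.factorial (n + 1)) / φ * expNegRemainder (n + 2) φ := by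
  simp only [Fn, expNegRemainder]
  ring

lemma Fn_pos (n : ℕ) {φ : ℝ} (hφ : 0 < φ) : 0 < Fn n φ := by
  rw [Fn_eq_expNegRemainder]
  have := expNegRemainder_pos (n + 2) hφ
  positivity

lemma Fn_le_pow (n : ℕ) {φ : ℝ} (hφ : 0 < φ) : Fn n φ ≤ φ ^ (n + 1) := by
  rw [Fn_eq_expNegRemainder]
  calc _ ≤ 2 * (Nat.factorial (n + 1)) / φ * (φ ^ (n + 2) / (Nat.factorial (n + 2))) := by
        gcongr
        exact expNegRemainder_le _ hφ.le
    _ = 2 / (n + 2) * φ ^ (n + 1) := by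
        have h : (Nat.factorial (n + 1) : ℝ) ≠ 0 := by positivity
        rw [Nat.factorial_succ (n + 1)]
        push_cast
        field_simp
        ring
    _ ≤ 1 * φ ^ (n + 1) := by
        gcongr
        rw [div_le_one (by positivity)]
        linarith [(Nat.cast_nonneg n : (0 : ℝ) ≤ n)]
    _ = φ ^ (n + 1) := one_mul _

lemma inv_le_sqrt_pow_div_Fn {n : ℕ} (hn : 1 ≤ n) {φ : ℝ} (hφ : 0 < φ) :
    φ⁻¹ ≤ Real.sqrt (φ ^ (n - 1) / Fn n φ) := by
  obtain ⟨m, rfl⟩ := Nat.exists_eq_add_of_le' hn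
  refine Real.le_sqrt_of_sq_le ?_
  rw [Nat.add_sub_cancel, le_div_iff₀ (Fn_pos _ hφ)]
  calc φ⁻¹ ^ 2 * Fn (m + 1) φ ≤ φ⁻¹ ^ 2 * φ ^ (m + 1 + 1) := by
        gcongr
        exact Fn_le_pow _ hφ
    _ = φ ^ m := by
        field_simp
        ring

lemma lintegral_eq_top_of_inv_le {s : Set ℝ} (hs : MeasurableSet s) (hpos : s ⊆ Ioi 0)
    (hinv : ¬ IntegrableOn (fun x : ℝ => x⁻¹) s) {f : ℝ → ℝ} (hf : ∀ x ∈ s, x⁻¹ ≤ f x) :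
    (∫⁻ x in s, ENNReal.ofReal (f x)) = ⊤ := by
  by_contra htop
  refine hinv ⟨measurable_inv.aestronglyMeasurable, ?_⟩
  rw [hasFiniteIntegral_iff_ofReal]
  · exact (setLIntegral_mono' hs fun x hx => ENNReal.ofReal_le_ofReal (hf x hx)).trans_lt
      (lt_top_iff_ne_top.2 htop)
  · filter_upwards [ae_restrict_mem hs] with x hx
    exact inv_nonneg.2 (le_of_lt (hpos hx))

lemma not_integrableOn_Ioo_zero_inv {a : ℝ} (ha : 0 < a) :
    ¬ IntegrableOn (fun x : ℝ => x⁻¹) (Ioo 0 a) := by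
  rw [← integrableOn_Ioc_iff_integrableOn_Ioo, ← intervalIntegrable_iff_integrableOn_Ioc_of_le ha.le,
    intervalIntegrable_inv_iff]
  simp [ha.ne, ha.le]

/-- For every integer `n ≥ 1` and every `φ₀ > 0`, the radial arclength integrals
`∫_{φ₀}^{∞} √(φ^{n−1}/Fn n φ) dφ` and `∫_{0}^{φ₀} √(φ^{n−1}/Fn n φ) dφ` both diverge to `+∞`. -/
theorem arclength_integrals_diverge (n : ℕ) (hn : 1 ≤ n) (φ₀ : ℝ) (hφ₀ : 0 < φ₀) :
    (∫⁻ φ in Set.Ioi φ₀, ENNReal.ofReal (Real.sqrt (φ ^ (n - 1) / Fn n φ))) = ⊤ ∧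
    (∫⁻ φ in Set.Ioo (0 : ℝ) φ₀, ENNReal.ofReal (Real.sqrt (φ ^ (n - 1) / Fn n φ))) = ⊤ :=
  ⟨lintegral_eq_top_of_inv_le measurableSet_Ioi (Ioi_subset_Ioi hφ₀.le) not_integrableOn_Ioi_inv
      fun _ hx => inv_le_sqrt_pow_div_Fn hn (hφ₀.trans hx),
    lintegral_eq_top_of_inv_le measurableSet_Ioo (fun _ hx => hx.1)
      (not_integrableOn_Ioo_zero_inv hφ₀) fun _ hx => inv_le_sqrt_pow_div_Fn hn hx.1⟩
end

section
/- Each of the three functions S_kt, S_xy, S_kx is strictly negative and strictly increasing on (0,∞); moreover S_kt(φ) → −2/3, S_xy(φ) → −2/3, and S_kx(φ) → −1/6 as φ → 0⁺, and all three tend to 0 as φ → ∞. -/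
open MeasureTheory Filter Set

/-- `F₁(φ) = (4/φ)·(1 − φ + φ²/2 − e^{−φ})`. -/
noncomputable def F1 (φ : ℝ) : ℝ :=
  4 / φ * (1 - φ + φ ^ 2 / 2 - Real.exp (-φ))

/-- `S_kt(φ) = −(1 + φ + φ²/2)·F₁(φ)/φ² + φ`. -/
noncomputable def Skt (φ : ℝ) : ℝ :=
  -(1 + φ + φ ^ 2 / 2) * F1 φ / φ ^ 2 + φ

/-- `S_xy(φ) = −F₁(φ)/φ²`. -/
noncomputable def Sxy (φ : ℝ) : ℝ :=
  -F1 φ / φ ^ 2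

/-- `S_kx(φ) = ((2 + φ)·F₁(φ)/φ² − 2)/4`. -/
noncomputable def Skx (φ : ℝ) : ℝ :=
  ((2 + φ) * F1 φ / φ ^ 2 - 2) / 4

lemma pos_of_hasDerivAt_pos {f f' : ℝ → ℝ} (h0 : f 0 = 0)
    (hf : ∀ x, HasDerivAt f (f' x) x) (hf' : ∀ x, 0 < x → 0 < f' x) {x : ℝ} (hx : 0 < x) :
    0 < f x := by
  have hmono : StrictMonoOn f (Ici 0) := by
    refine strictMonoOn_of_deriv_pos (convex_Ici 0)
      (fun y _ => (hf y).continuousAt.continuousWithinAt) fun y hy => ?_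
    rw [(hf y).deriv]
    exact hf' y (by simpa using hy)
  simpa [h0] using hmono self_mem_Ici hx.le hx

lemma strictMonoOn_Ioi_of_hasDerivAt_pos {f f' : ℝ → ℝ}
    (hf : ∀ x, 0 < x → HasDerivAt f (f' x) x) (hf' : ∀ x, 0 < x → 0 < f' x) :
    StrictMonoOn f (Ioi 0) := by
  refine strictMonoOn_of_deriv_pos (convex_Ioi 0)
    (fun y hy => (hf y hy).continuousAt.continuousWithinAt) fun y hy => ?_
  rw [interior_Ioi] at hy
  rw [(hf y hy).deriv]
  exact hf' y hy

lemma neg_of_strictMonoOn_of_tendsto_zero {f : ℝ → ℝ} (hf : StrictMonoOn f (Ioi 0))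
    (hlim : Tendsto f atTop (nhds 0)) {x : ℝ} (hx : 0 < x) : f x < 0 := by
  have hx1 : 0 < x + 1 := by linarith
  refine (hf hx hx1 (lt_add_one x)).trans_le (ge_of_tendsto hlim ?_)
  filter_upwards [eventually_ge_atTop (x + 1)] with y hy
  exact hf.monotoneOn hx1 (hx1.trans_le hy) hy

lemma hasDerivAt_exp_neg (x : ℝ) :
    HasDerivAt (fun y : ℝ => Real.exp (-y)) (-Real.exp (-x)) x := by
  simpa using (hasDerivAt_neg x).exp

lemma hasDerivAt_mul_exp_neg {p : ℝ → ℝ} {p' x : ℝ} (hp : HasDerivAt p p' x) :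
    HasDerivAt (fun y => p y * Real.exp (-y)) ((p' - p x) * Real.exp (-x)) x :=
  (hp.mul (hasDerivAt_exp_neg x)).congr_deriv (by ring)

lemma hasDerivAt_div_cube {n : ℝ → ℝ} {n' x : ℝ} (hn : HasDerivAt n n' x) (hx : 0 < x) :
    HasDerivAt (fun y => n y / y ^ 3) ((x * n' - 3 * n x) / x ^ 4) x := by
  refine (hn.div (hasDerivAt_pow 3 x) (by positivity)).congr_deriv ?_
  field_simp
  ring

lemma hasDerivAt_quadratic (a b c x : ℝ) :
    HasDerivAt (fun y : ℝ => a + b * y + c * y ^ 2) (b + 2 * c * x) x := by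
  refine ((((hasDerivAt_id x).const_mul b).const_add a).add
    ((hasDerivAt_pow 2 x).const_mul c)).congr_deriv ?_
  norm_num
  ring

/-- Polynomials of degree two plus such polynomials times `e^{-y}`. -/
lemma hasDerivAt_quadratic_add_mul_exp_neg (a b c a' b' c' x : ℝ) :
    HasDerivAt (fun y : ℝ => a + b * y + c * y ^ 2 + (a' + b' * y + c' * y ^ 2) * Real.exp (-y))
      (b + 2 * c * x + (b' + 2 * c' * x - (a' + b' * x + c' * x ^ 2)) * Real.exp (-x)) x :=
  (hasDerivAt_quadratic a b c x).add (hasDerivAt_mul_exp_neg (hasDerivAt_quadratic a' b' c' x))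

lemma sum_mul_exp_neg_lt_one (n : ℕ) {x : ℝ} (hx : 0 < x) :
    (∑ i ∈ Finset.range n, x ^ i / i.factorial) * Real.exp (-x) < 1 := by
  have h := Real.sum_le_exp_of_nonneg hx.le (n + 1)
  rw [Finset.sum_range_succ] at h
  have hpos : 0 < x ^ n / (n.factorial : ℝ) := by positivity
  rw [Real.exp_neg, ← div_eq_mul_inv, div_lt_one (Real.exp_pos x)]
  linarith

lemma Sxy_eq {x : ℝ} (hx : x ≠ 0) :
    Sxy x = (-4 + 4 * x + -2 * x ^ 2 + (4 + 0 * x + 0 * x ^ 2) * Real.exp (-x)) / x ^ 3 := by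
  unfold Sxy F1
  field_simp
  ring

lemma Skt_eq {x : ℝ} (hx : x ≠ 0) :
    Skt x = (-4 + 0 * x + 0 * x ^ 2 + (4 + 4 * x + 2 * x ^ 2) * Real.exp (-x)) / x ^ 3 := by
  unfold Skt F1
  field_simp
  ring

lemma Skx_eq {x : ℝ} (hx : x ≠ 0) :
    Skx x = (2 + -1 * x + 0 * x ^ 2 + (-2 + -1 * x + 0 * x ^ 2) * Real.exp (-x)) / x ^ 3 := by
  unfold Skx F1
  field_simp
  ring

lemma strictMonoOn_of_eq_div_cube {f : ℝ → ℝ} {a b c a' b' c' : ℝ}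
    (hf : ∀ x, x ≠ 0 →
      f x = (a + b * x + c * x ^ 2 + (a' + b' * x + c' * x ^ 2) * Real.exp (-x)) / x ^ 3)
    (hpos : ∀ x, 0 < x →
      0 < x * (b + 2 * c * x + (b' + 2 * c' * x - (a' + b' * x + c' * x ^ 2)) * Real.exp (-x)) -
        3 * (a + b * x + c * x ^ 2 + (a' + b' * x + c' * x ^ 2) * Real.exp (-x))) :
    StrictMonoOn f (Ioi 0) := by
  refine StrictMonoOn.congr (strictMonoOn_Ioi_of_hasDerivAt_pos
    (fun x hx => hasDerivAt_div_cube
      (hasDerivAt_quadratic_add_mul_exp_neg a b c a' b' c' x) hx)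
    fun x hx => div_pos (hpos x hx) (by positivity)) fun x hx => (hf x (ne_of_gt hx)).symm

lemma tendsto_atTop_zero_of_eq_div_cube {f : ℝ → ℝ} {a b c a' b' c' : ℝ}
    (hf : ∀ x, x ≠ 0 →
      f x = (a + b * x + c * x ^ 2 + (a' + b' * x + c' * x ^ 2) * Real.exp (-x)) / x ^ 3) :
    Tendsto f atTop (nhds 0) := by
  have hE : Tendsto (fun x : ℝ => Real.exp (-x)) atTop (nhds 0) :=
    Real.tendsto_exp_neg_atTop_nhds_zero
  have hu : Tendsto (fun x : ℝ => x⁻¹) atTop (nhds 0) := tendsto_inv_atTop_zero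
  have hq (a b c : ℝ) :
      Tendsto (fun x : ℝ => a * x⁻¹ ^ 3 + b * x⁻¹ ^ 2 + c * x⁻¹) atTop (nhds 0) := by
    simpa using (((hu.pow 3).const_mul a).add ((hu.pow 2).const_mul b)).add (hu.const_mul c)
  have h := (hq a b c).add ((hq a' b' c').mul hE)
  rw [mul_zero, add_zero] at h
  refine h.congr' ?_
  filter_upwards [eventually_gt_atTop 0] with x hx
  rw [hf x hx.ne']
  field_simp

lemma add_mul_exp_neg_sub_pos {x : ℝ} (hx : 0 < x) :
    0 < -2 + 1 * x + 0 * x ^ 2 + (2 + 1 * x + 0 * x ^ 2) * Real.exp (-x) := by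
  refine pos_of_hasDerivAt_pos
    (f := fun x => -2 + 1 * x + 0 * x ^ 2 + (2 + 1 * x + 0 * x ^ 2) * Real.exp (-x)) (by simp)
    (hasDerivAt_quadratic_add_mul_exp_neg _ _ _ _ _ _) (fun y hy => ?_) hx
  have := sum_mul_exp_neg_lt_one 2 hy
  norm_num [Finset.sum_range_succ] at this
  linarith

lemma strictMonoOn_Sxy : StrictMonoOn Sxy (Ioi 0) := by
  refine strictMonoOn_of_eq_div_cube (fun x => Sxy_eq) fun x hx => ?_
  have := pos_of_hasDerivAt_pos
    (f := fun x => 3 + -2 * x + 1 / 2 * x ^ 2 + (-3 + -1 * x + 0 * x ^ 2) * Real.exp (-x))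
    (by simp) (hasDerivAt_quadratic_add_mul_exp_neg _ _ _ _ _ _)
    (fun y hy => by linarith [add_mul_exp_neg_sub_pos hy]) hx
  linarith

lemma strictMonoOn_Skt : StrictMonoOn Skt (Ioi 0) := by
  refine strictMonoOn_of_eq_div_cube (fun x => Skt_eq) fun x hx => ?_
  have := sum_mul_exp_neg_lt_one 4 hx
  norm_num [Finset.sum_range_succ, Nat.factorial] at this
  linarith

lemma strictMonoOn_Skx : StrictMonoOn Skx (Ioi 0) := by
  refine strictMonoOn_of_eq_div_cube (fun x => Skx_eq) fun x hx => ?_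
  have := pos_of_hasDerivAt_pos
    (f := fun x => -6 + 2 * x + 0 * x ^ 2 + (6 + 4 * x + 1 * x ^ 2) * Real.exp (-x))
    (by simp) (hasDerivAt_quadratic_add_mul_exp_neg _ _ _ _ _ _)
    (fun y hy => by
      have := sum_mul_exp_neg_lt_one 3 hy
      norm_num [Finset.sum_range_succ, Nat.factorial] at this
      linarith) hx
  linarith

lemma tendsto_Sxy_zero : Tendsto Sxy (nhdsWithin 0 (Ioi 0)) (nhds (-2 / 3)) := by
  have hneg : Tendsto (fun x : ℝ => -x) (nhdsWithin 0 (Ioi 0)) (nhds 0) := by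
    simpa using (continuous_neg.tendsto (0 : ℝ)).mono_left nhdsWithin_le_nhds
  have h := ((Real.exp_sub_sum_range_succ_isLittleO_pow 3).comp_tendsto hneg).tendsto_div_nhds_zero
  have h' := (h.const_mul (-4)).add_const (-2 / 3)
  rw [mul_zero, zero_add] at h'
  refine h'.congr' ?_
  filter_upwards [self_mem_nhdsWithin] with x hx
  have hx0 : x ≠ 0 := ne_of_gt hx
  rw [Sxy_eq hx0]
  norm_num [Finset.sum_range_succ, Nat.factorial]
  field_simp
  ring

lemma tendsto_Skt_zero : Tendsto Skt (nhdsWithin 0 (Ioi 0)) (nhds (-2 / 3)) := by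
  have hid : Tendsto (fun x : ℝ => x) (nhdsWithin 0 (Ioi 0)) (nhds 0) :=
    tendsto_id.mono_left nhdsWithin_le_nhds
  have h := (((hid.const_add 1).add ((hid.pow 2).div_const 2)).mul tendsto_Sxy_zero).add hid
  convert h using 2
  · simp only [Skt, Sxy]
    ring
  · norm_num

lemma tendsto_Skx_zero : Tendsto Skx (nhdsWithin 0 (Ioi 0)) (nhds (-1 / 6)) := by
  have hid : Tendsto (fun x : ℝ => x) (nhdsWithin 0 (Ioi 0)) (nhds 0) :=
    tendsto_id.mono_left nhdsWithin_le_nhds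
  have h := (((hid.const_add 2).neg.mul tendsto_Sxy_zero).sub_const 2).div_const 4
  convert h using 2
  · simp only [Skx, Sxy]
    ring
  · norm_num

/-- Each of the frame sectional curvature functions `S_kt`, `S_xy`, `S_kx` of the
four-dimensional Heisenberg Kähler–Ricci soliton is strictly negative and strictly
increasing on `(0,∞)`; moreover `S_kt → −2/3`, `S_xy → −2/3`, `S_kx → −1/6` as `φ → 0⁺`,
and all three tend to `0` as `φ → ∞`. -/
theorem frame_sec_properties :
    (∀ φ : ℝ, 0 < φ → Skt φ < 0) ∧ StrictMonoOn Skt (Set.Ioi 0) ∧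
    (∀ φ : ℝ, 0 < φ → Sxy φ < 0) ∧ StrictMonoOn Sxy (Set.Ioi 0) ∧
    (∀ φ : ℝ, 0 < φ → Skx φ < 0) ∧ StrictMonoOn Skx (Set.Ioi 0) ∧
    Tendsto Skt (nhdsWithin 0 (Set.Ioi 0)) (nhds (-2 / 3)) ∧
    Tendsto Sxy (nhdsWithin 0 (Set.Ioi 0)) (nhds (-2 / 3)) ∧
    Tendsto Skx (nhdsWithin 0 (Set.Ioi 0)) (nhds (-1 / 6)) ∧
    Tendsto Skt atTop (nhds 0) ∧
    Tendsto Sxy atTop (nhds 0) ∧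
    Tendsto Skx atTop (nhds 0) := by
  have hkt : Tendsto Skt atTop (nhds 0) := tendsto_atTop_zero_of_eq_div_cube fun x => Skt_eq
  have hxy : Tendsto Sxy atTop (nhds 0) := tendsto_atTop_zero_of_eq_div_cube fun x => Sxy_eq
  have hkx : Tendsto Skx atTop (nhds 0) := tendsto_atTop_zero_of_eq_div_cube fun x => Skx_eq
  exact ⟨fun x hx => neg_of_strictMonoOn_of_tendsto_zero strictMonoOn_Skt hkt hx, strictMonoOn_Skt,
    fun x hx => neg_of_strictMonoOn_of_tendsto_zero strictMonoOn_Sxy hxy hx, strictMonoOn_Sxy,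
    fun x hx => neg_of_strictMonoOn_of_tendsto_zero strictMonoOn_Skx hkx hx, strictMonoOn_Skx,
    tendsto_Skt_zero, tendsto_Sxy_zero, tendsto_Skx_zero, hkt, hxy, hkx⟩
end
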